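/- arXiv:1610.01449 — 4 statements merged into one kernel-verified Lean document; each statement's English description precedes it below -/
import Mathlib

section
/- Let n ≥ 1 and let u = (u_1,…,u_n) and v = (v_1,…,v_n) be n-tuples of real numbers with u_i ≥ 1 and v_i ≥ 1 for all i. If v is majorized by u, then for every real p with 0 < p < 1 one has Σ_{i=1}^n ((u_i + √(u_i² − 1))^p + (u_i − √(u_i² − 1))^p) ≤ Σ_{i=1}^n ((v_i + √(v_i² − 1))^p + (v_i − √(v_i² − 1))^p). (This is the 0 < p < 1 half of the power majorization of the roots of Q(t) = ∏_i (t² − 2v_i t + 1) by the roots of P(t) = ∏_i (t² − 2u_i t + 1).) -/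
/-- The sum of the `k` largest entries of `x`, expressed as the supremum of the
sums of `x` over all subsets of cardinality `k`. -/
noncomputable def kLargestSum {n : ℕ} (x : Fin n → ℝ) (k : ℕ) : ℝ :=
  sSup {y : ℝ | ∃ s : Finset (Fin n), s.card = k ∧ y = ∑ i ∈ s, x i}

/-- `v` is majorized by `u`: for each `k` from `1` to `n-1` the sum of the `k` largest
entries of `v` is at most the sum of the `k` largest entries of `u`, and the total
sums are equal. -/
def IsMajorizedBy {n : ℕ} (v u : Fin n → ℝ) : Prop :=
  (∀ k : ℕ, 1 ≤ k → k ≤ n - 1 → kLargestSum v k ≤ kLargestSum u k) ∧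
  ∑ i, v i = ∑ i, u i

theorem Antitone.sum_le_sum_filter_lt_card {n : ℕ} {x : Fin n → ℝ} (hx : Antitone x)
    (s : Finset (Fin n)) : ∑ i ∈ s, x i ≤ ∑ i with i.val < s.card, x i := by
  rcases lt_or_ge s.card n with hk | hk
  · set c := x ⟨s.card, hk⟩
    have h₁ : ∑ i ∈ s, (x i - c) ≤ ∑ i, max (x i - c) 0 :=
      (Finset.sum_le_sum fun i _ => le_max_left _ _).trans
        (Finset.sum_le_sum_of_subset_of_nonneg s.subset_univ fun i _ _ => le_max_right _ _)
    have h₂ : ∑ i, max (x i - c) 0 = ∑ i with i.val < s.card, (x i - c) := by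
      rw [Finset.sum_filter]
      refine Finset.sum_congr rfl fun i _ => ?_
      split_ifs with hi
      · exact max_eq_left (sub_nonneg.2 (hx (Fin.le_def.2 hi.le)))
      · exact max_eq_right (sub_nonpos.2 (hx (Fin.le_def.2 (not_lt.1 hi))))
    have hcard : (Finset.univ.filter fun i : Fin n => i.val < s.card).card = s.card := by
      rw [Fin.card_filter_val_lt, min_eq_right hk.le]
    rw [h₂, Finset.sum_sub_distrib, Finset.sum_sub_distrib, Finset.sum_const, Finset.sum_const,
      hcard] at h₁
    linarith
  · have hs : s = Finset.univ :=
      Finset.eq_univ_of_card s (le_antisymm s.card_le_univ (by simpa using hk))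
    subst hs
    simp

theorem Fin.sum_filter_lt_mul_le_mul_sum {n : ℕ} {G d : Fin n → ℝ} (hG : Monotone G)
    (hd : ∀ k ≤ n, 0 ≤ ∑ j : Fin n with j.val < k, d j) (k : ℕ) (i : Fin n) (hk : k ≤ i.val + 1) :
    ∑ j : Fin n with j.val < k, G j * d j ≤ G i * ∑ j : Fin n with j.val < k, d j := by
  induction k generalizing i with
  | zero => simp
  | succ k ih =>
    have hkn : k < n := by omega
    have hfilter : (Finset.univ.filter fun j : Fin n => j.val < k + 1) =
        insert ⟨k, hkn⟩ (Finset.univ.filter fun j : Fin n => j.val < k) := by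
      ext j
      simp [Fin.ext_iff]
      omega
    have hstep (a : Fin n → ℝ) : ∑ j : Fin n with j.val < k + 1, a j =
        a ⟨k, hkn⟩ + ∑ j : Fin n with j.val < k, a j := by
      rw [hfilter, Finset.sum_insert (by simp)]
    calc ∑ j : Fin n with j.val < k + 1, G j * d j
        ≤ G ⟨k, hkn⟩ * ∑ j : Fin n with j.val < k + 1, d j := by
          rw [hstep, hstep, mul_add]
          gcongr
          exact ih ⟨k, hkn⟩ (by simp)
      _ ≤ _ := mul_le_mul_of_nonneg_right (hG (Fin.le_def.2 (by simpa using hk)))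
          (hd (k + 1) hkn)

theorem sum_le_kLargestSum {n : ℕ} (x : Fin n → ℝ) (s : Finset (Fin n)) :
    ∑ i ∈ s, x i ≤ kLargestSum x s.card := by
  refine le_csSup (Set.Finite.bddAbove ?_) ⟨s, rfl, rfl⟩
  refine (Set.finite_range fun t : Finset (Fin n) => ∑ i ∈ t, x i).subset ?_
  rintro _ ⟨t, -, rfl⟩
  exact ⟨t, rfl⟩

theorem kLargestSum_le_sum_filter {n k : ℕ} {x : Fin n → ℝ} {τ : Equiv.Perm (Fin n)}
    (hτ : Antitone (x ∘ τ)) (hk : k ≤ n) :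
    kLargestSum x k ≤ ∑ i with i.val < k, x (τ i) := by
  refine csSup_le ?_ ?_
  · obtain ⟨s, -, hs⟩ := Finset.exists_subset_card_eq
      (show k ≤ (Finset.univ : Finset (Fin n)).card by simpa using hk)
    exact ⟨_, s, hs, rfl⟩
  · rintro _ ⟨t, rfl, rfl⟩
    simpa using hτ.sum_le_sum_filter_lt_card (t.map τ.symm.toEmbedding)

theorem exists_perm_antitone_comp {n : ℕ} (x : Fin n → ℝ) :
    ∃ σ : Equiv.Perm (Fin n), Antitone (x ∘ σ) :=
  ⟨Tuple.sort (-x), fun _ _ hij => neg_le_neg_iff.1 (Tuple.monotone_sort (-x) hij)⟩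

/-- The majorization inequality of Karamata, for a function `f` with antitone supergradient `g`. -/
theorem IsMajorizedBy.sum_le_sum {n : ℕ} {u v : Fin n → ℝ} (h : IsMajorizedBy v u) {S : Set ℝ}
    {f g : ℝ → ℝ} (hu : ∀ i, u i ∈ S) (hv : ∀ i, v i ∈ S) (hg : AntitoneOn g S)
    (hfg : ∀ x ∈ S, ∀ y ∈ S, f y - f x ≤ g x * (y - x)) :
    ∑ i, f (u i) ≤ ∑ i, f (v i) := by
  obtain ⟨σ, hσ⟩ := exists_perm_antitone_comp v
  obtain ⟨τ, hτ⟩ := exists_perm_antitone_comp u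
  have htotal : ∑ i, (u (τ i) - v (σ i)) = 0 := by
    rw [Finset.sum_sub_distrib, Equiv.sum_comp τ u, Equiv.sum_comp σ v, h.2, sub_self]
  have hpartial (k : ℕ) (hk : k ≤ n) :
      0 ≤ ∑ i : Fin n with i.val < k, (u (τ i) - v (σ i)) := by
    rcases Nat.eq_zero_or_pos k with rfl | hk0
    · simp
    rcases hk.eq_or_lt with rfl | hkn
    · simp [htotal]
    have hcard : ((Finset.univ.filter fun i : Fin n => i.val < k).map σ.toEmbedding).card = k := by
      rw [Finset.card_map, Fin.card_filter_val_lt, min_eq_right hk]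
    have hle := sum_le_kLargestSum v
      ((Finset.univ.filter fun i : Fin n => i.val < k).map σ.toEmbedding)
    rw [hcard, Finset.sum_map] at hle
    rw [Finset.sum_sub_distrib, sub_nonneg]
    exact hle.trans ((h.1 k hk0 (by omega)).trans (kLargestSum_le_sum_filter hτ hk))
  rcases n with _ | n
  · simp
  have habel := Fin.sum_filter_lt_mul_le_mul_sum (G := fun i => g (v (σ i)))
    (fun i j hij => hg (hv _) (hv _) (hσ hij)) hpartial (n + 1) (Fin.last n) (by simp)
  simp only [Fin.is_lt, Finset.filter_true, htotal, mul_zero] at habel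
  rw [← Equiv.sum_comp τ fun i => f (u i), ← Equiv.sum_comp σ fun i => f (v i), ← sub_nonpos,
    ← Finset.sum_sub_distrib]
  exact (Finset.sum_le_sum fun i _ => hfg _ (hv _) _ (hu _)).trans habel

namespace Real

theorem mul_cosh_mul_sinh_le {p t : ℝ} (hp0 : 0 ≤ p) (hp1 : p ≤ 1) (ht : 0 ≤ t) :
    p * cosh (p * t) * sinh t ≤ sinh (p * t) * cosh t := by
  have hderiv (x : ℝ) : HasDerivAt (fun x => p * cosh (p * x) * sinh x - sinh (p * x) * cosh x)
      ((p ^ 2 - 1) * (sinh (p * x) * sinh x)) x := by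
    have hpx : HasDerivAt (fun x => p * x) p x := by simpa using (hasDerivAt_id x).const_mul p
    refine HasDerivAt.congr_deriv (((hpx.cosh.const_mul p).mul (hasDerivAt_sinh x)).sub
      (hpx.sinh.mul (hasDerivAt_cosh x))) ?_
    ring
  have hanti : AntitoneOn (fun x => p * cosh (p * x) * sinh x - sinh (p * x) * cosh x)
      (Set.Ici 0) := by
    refine antitoneOn_of_deriv_nonpos (convex_Ici 0)
      (fun x _ => (hderiv x).continuousAt.continuousWithinAt)
      (fun x _ => (hderiv x).differentiableAt.differentiableWithinAt) fun x hx => ?_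
    rw [interior_Ici, Set.mem_Ioi] at hx
    rw [(hderiv x).deriv]
    exact mul_nonpos_of_nonpos_of_nonneg (by nlinarith)
      (mul_nonneg (sinh_nonneg_iff.2 (by positivity)) (sinh_nonneg_iff.2 hx.le))
  simpa using hanti (Set.mem_Ici.2 le_rfl) ht ht

theorem sinh_mul_le_mul_sinh {p t : ℝ} (hp0 : 0 ≤ p) (hp1 : p ≤ 1) (ht : 0 ≤ t) :
    sinh (p * t) ≤ p * sinh t := by
  have hderiv (x : ℝ) : HasDerivAt (fun x => p * sinh x - sinh (p * x))
      (p * (cosh x - cosh (p * x))) x := by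
    have hpx : HasDerivAt (fun x => p * x) p x := by simpa using (hasDerivAt_id x).const_mul p
    refine HasDerivAt.congr_deriv (((hasDerivAt_sinh x).const_mul p).sub hpx.sinh) ?_
    ring
  have hmono : MonotoneOn (fun x => p * sinh x - sinh (p * x)) (Set.Ici 0) := by
    refine monotoneOn_of_deriv_nonneg (convex_Ici 0)
      (fun x _ => (hderiv x).continuousAt.continuousWithinAt)
      (fun x _ => (hderiv x).differentiableAt.differentiableWithinAt) fun x hx => ?_
    rw [interior_Ici, Set.mem_Ioi] at hx
    rw [(hderiv x).deriv]
    refine mul_nonneg hp0 (sub_nonneg.2 (cosh_le_cosh.2 ?_))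
    rw [abs_of_nonneg (by positivity), abs_of_pos hx]
    nlinarith
  simpa using hmono (Set.mem_Ici.2 le_rfl) ht ht

/-- The quotient `sinh (p * t) / sinh t`, extended by its limit `p` at `t = 0`. -/
noncomputable def sinhRatio (p t : ℝ) : ℝ := if t = 0 then p else sinh (p * t) / sinh t

theorem sinhRatio_mul_sinh (p t : ℝ) : sinhRatio p t * sinh t = sinh (p * t) := by
  rw [sinhRatio]
  split_ifs with ht
  · simp [ht]
  · exact div_mul_cancel₀ _ (sinh_ne_zero.2 ht)

theorem sinhRatio_antitoneOn {p : ℝ} (hp0 : 0 ≤ p) (hp1 : p ≤ 1) :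
    AntitoneOn (sinhRatio p) (Set.Ici 0) := by
  have hpos : AntitoneOn (fun t => sinh (p * t) / sinh t) (Set.Ioi 0) := by
    have hderiv (x : ℝ) (hx : 0 < x) : HasDerivAt (fun t => sinh (p * t) / sinh t)
        ((p * cosh (p * x) * sinh x - sinh (p * x) * cosh x) / sinh x ^ 2) x := by
      have hpx : HasDerivAt (fun x => p * x) p x := by simpa using (hasDerivAt_id x).const_mul p
      refine HasDerivAt.congr_deriv (hpx.sinh.div (hasDerivAt_sinh x) (sinh_pos_iff.2 hx).ne') ?_
      ring
    refine antitoneOn_of_deriv_nonpos (convex_Ioi 0)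
      (fun x hx => (hderiv x hx).continuousAt.continuousWithinAt) ?_ ?_ <;>
      rw [interior_Ioi]
    · exact fun x hx => (hderiv x hx).differentiableAt.differentiableWithinAt
    · intro x hx
      rw [(hderiv x hx).deriv]
      exact div_nonpos_of_nonpos_of_nonneg
        (sub_nonpos.2 (mul_cosh_mul_sinh_le hp0 hp1 (le_of_lt hx))) (sq_nonneg _)
  intro a ha b hb hab
  rcases (Set.mem_Ici.1 hb).eq_or_lt with rfl | hb'
  · rw [le_antisymm hab ha]
  rcases (Set.mem_Ici.1 ha).eq_or_lt with rfl | ha'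
  · rw [sinhRatio, sinhRatio, if_neg hb'.ne', if_pos rfl, div_le_iff₀ (sinh_pos_iff.2 hb')]
    exact sinh_mul_le_mul_sinh hp0 hp1 hb
  · rw [sinhRatio, sinhRatio, if_neg hb'.ne', if_neg ha'.ne']
    exact hpos ha' hb' hab

theorem cosh_mul_sub_cosh_mul_le {p s t : ℝ} (hp0 : 0 ≤ p) (hp1 : p ≤ 1) (hs : 0 ≤ s)
    (ht : 0 ≤ t) :
    cosh (p * s) - cosh (p * t) ≤ p * sinhRatio p t * (cosh s - cosh t) := by
  set h : ℝ → ℝ := fun x => p * sinhRatio p t * cosh x - cosh (p * x) with hh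
  have hderiv (x : ℝ) :
      HasDerivAt h (p * (sinh x * (sinhRatio p t - sinhRatio p x))) x := by
    have hpx : HasDerivAt (fun x => p * x) p x := by simpa using (hasDerivAt_id x).const_mul p
    refine HasDerivAt.congr_deriv
      (((hasDerivAt_cosh x).const_mul (p * sinhRatio p t)).sub hpx.cosh) ?_
    rw [← sinhRatio_mul_sinh p x]
    ring
  have hanti := sinhRatio_antitoneOn hp0 hp1
  suffices h t ≤ h s by
    simp only [hh] at this
    linarith
  rcases le_total s t with hst | hts
  · have hmono : AntitoneOn h (Set.Icc s t) := by
      refine antitoneOn_of_deriv_nonpos (convex_Icc s t)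
        (fun x _ => (hderiv x).continuousAt.continuousWithinAt)
        (fun x _ => (hderiv x).differentiableAt.differentiableWithinAt) fun x hx => ?_
      have hx := interior_subset hx
      have hx0 : 0 ≤ x := hs.trans hx.1
      rw [(hderiv x).deriv]
      exact mul_nonpos_of_nonneg_of_nonpos hp0 (mul_nonpos_of_nonneg_of_nonpos
        (sinh_nonneg_iff.2 hx0) (sub_nonpos.2 (hanti hx0 ht hx.2)))
    exact hmono (Set.left_mem_Icc.2 hst) (Set.right_mem_Icc.2 hst) hst
  · have hmono : MonotoneOn h (Set.Icc t s) := by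
      refine monotoneOn_of_deriv_nonneg (convex_Icc t s)
        (fun x _ => (hderiv x).continuousAt.continuousWithinAt)
        (fun x _ => (hderiv x).differentiableAt.differentiableWithinAt) fun x hx => ?_
      have hx := interior_subset hx
      have hx0 : 0 ≤ x := ht.trans hx.1
      rw [(hderiv x).deriv]
      exact mul_nonneg hp0 (mul_nonneg (sinh_nonneg_iff.2 hx0)
        (sub_nonneg.2 (hanti ht hx0 hx.1)))
    exact hmono (Set.left_mem_Icc.2 hts) (Set.right_mem_Icc.2 hts) hts

theorem rpow_add_rpow_eq_two_mul_cosh {x : ℝ} (hx : 1 ≤ x) (p : ℝ) :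
    (x + √(x ^ 2 - 1)) ^ p + (x - √(x ^ 2 - 1)) ^ p = 2 * cosh (p * arcosh x) := by
  rw [← add_sqrt_self_sq_sub_one_inv hx, ← exp_arcosh hx, ← exp_neg, ← exp_mul, ← exp_mul,
    cosh_eq, mul_comm p, neg_mul]
  ring

end Real

theorem power_majorization_lt_one (n : ℕ) (hn : 1 ≤ n) (u v : Fin n → ℝ)
    (hu : ∀ i, 1 ≤ u i) (hv : ∀ i, 1 ≤ v i) (hmaj : IsMajorizedBy v u)
    (p : ℝ) (hp0 : 0 < p) (hp1 : p < 1) :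
    ∑ i, ((u i + Real.sqrt ((u i) ^ 2 - 1)) ^ p + (u i - Real.sqrt ((u i) ^ 2 - 1)) ^ p) ≤
      ∑ i, ((v i + Real.sqrt ((v i) ^ 2 - 1)) ^ p + (v i - Real.sqrt ((v i) ^ 2 - 1)) ^ p) := by
  simp_rw [fun i => Real.rpow_add_rpow_eq_two_mul_cosh (hu i) p,
    fun i => Real.rpow_add_rpow_eq_two_mul_cosh (hv i) p, ← Finset.mul_sum]
  refine mul_le_mul_of_nonneg_left ?_ zero_le_two
  refine hmaj.sum_le_sum (S := Set.Ici 1) (f := fun x => Real.cosh (p * Real.arcosh x))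
    (g := fun x => p * Real.sinhRatio p (Real.arcosh x)) hu hv ?_ ?_
  · intro x hx y hy hxy
    refine mul_le_mul_of_nonneg_left ?_ hp0.le
    exact Real.sinhRatio_antitoneOn hp0.le hp1.le (Real.arcosh_nonneg hx) (Real.arcosh_nonneg hy)
      ((Real.arcosh_le_arcosh (zero_lt_one.trans_le hx) (zero_lt_one.trans_le hy)).2 hxy)
  · intro x hx y hy
    simpa only [Real.cosh_arcosh hx, Real.cosh_arcosh hy] using
      Real.cosh_mul_sub_cosh_mul_le hp0.le hp1.le (Real.arcosh_nonneg hy) (Real.arcosh_nonneg hx)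
end

section
/- Fix a real number p ≥ 1. The function g defined for t > 1 by g(t) = ((t + √(t² − 1))^p − (t − √(t² − 1))^p)/√(t² − 1) is monotone increasing on (1, ∞): for all 1 < s ≤ t one has g(s) ≤ g(t). -/
theorem Real.sinh_mul_mul_cosh_le {p u : ℝ} (hp : 1 ≤ p) (hu : 0 ≤ u) :
    Real.sinh (p * u) * Real.cosh u ≤ p * Real.cosh (p * u) * Real.sinh u := by
  have hd (x : ℝ) : HasDerivAt
      (fun x ↦ p * Real.cosh (p * x) * Real.sinh x - Real.sinh (p * x) * Real.cosh x)
      ((p ^ 2 - 1) * (Real.sinh (p * x) * Real.sinh x)) x := by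
    have hl : HasDerivAt (fun x : ℝ ↦ p * x) p x := by
      simpa using (hasDerivAt_id x).const_mul p
    refine (((hl.cosh.const_mul p).mul (Real.hasDerivAt_sinh x)).sub
      (hl.sinh.mul (Real.hasDerivAt_cosh x))).congr_deriv ?_
    ring
  have hmono := monotoneOn_of_hasDerivWithinAt_nonneg (convex_Ici (0 : ℝ))
    (fun x _ ↦ (hd x).continuousAt.continuousWithinAt)
    (fun x _ ↦ (hd x).hasDerivWithinAt) (fun x hx ↦ by
      have hx : 0 < x := by simpa using hx
      have h₁ : 0 ≤ Real.sinh (p * x) := Real.sinh_nonneg_iff.2 (by positivity)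
      have h₂ : 0 ≤ Real.sinh x := Real.sinh_nonneg_iff.2 hx.le
      have h₃ : 0 ≤ p ^ 2 - 1 := by nlinarith
      positivity)
  have := hmono (Set.self_mem_Ici) (Set.mem_Ici.2 hu) hu
  simpa using this

theorem Real.monotoneOn_sinh_mul_div_sinh {p : ℝ} (hp : 1 ≤ p) :
    MonotoneOn (fun u ↦ Real.sinh (p * u) / Real.sinh u) (Set.Ioi 0) := by
  have hd (x : ℝ) (hx : 0 < x) : HasDerivAt (fun u ↦ Real.sinh (p * u) / Real.sinh u)
      ((p * Real.cosh (p * x) * Real.sinh x - Real.sinh (p * x) * Real.cosh x) /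
        Real.sinh x ^ 2) x := by
    have hl : HasDerivAt (fun x : ℝ ↦ p * x) p x := by
      simpa using (hasDerivAt_id x).const_mul p
    refine (hl.sinh.div (Real.hasDerivAt_sinh x) (Real.sinh_pos_iff.2 hx).ne').congr_deriv ?_
    ring
  refine monotoneOn_of_hasDerivWithinAt_nonneg (convex_Ioi (0 : ℝ))
    (fun x hx ↦ (hd x hx).continuousAt.continuousWithinAt)
    (fun x hx ↦ (hd x (interior_subset hx)).hasDerivWithinAt) (fun x hx ↦ ?_)
  have hx : 0 < x := interior_subset hx
  exact div_nonneg (sub_nonneg.2 (Real.sinh_mul_mul_cosh_le hp hx.le)) (sq_nonneg _)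

theorem rpow_sub_rpow_div_sqrt_eq_sinh (p : ℝ) {t : ℝ} (ht : 1 < t) :
    ((t + Real.sqrt (t ^ 2 - 1)) ^ p - (t - Real.sqrt (t ^ 2 - 1)) ^ p) / Real.sqrt (t ^ 2 - 1) =
      2 * (Real.sinh (p * Real.arsinh (Real.sqrt (t ^ 2 - 1))) /
        Real.sinh (Real.arsinh (Real.sqrt (t ^ 2 - 1)))) := by
  have hc : Real.cosh (Real.arsinh (Real.sqrt (t ^ 2 - 1))) = t := by
    rw [Real.cosh_arsinh, Real.sq_sqrt (by nlinarith), add_sub_cancel, Real.sqrt_sq (by linarith)]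
  have hs := Real.sinh_arsinh (Real.sqrt (t ^ 2 - 1))
  generalize Real.arsinh (Real.sqrt (t ^ 2 - 1)) = u at hc hs ⊢
  rw [← hs, ← hc, Real.cosh_add_sinh, Real.cosh_sub_sinh, ← Real.exp_mul, ← Real.exp_mul,
    Real.sinh_eq (p * u)]
  ring_nf

theorem g_monotone_ge_one (p : ℝ) (hp : 1 ≤ p) (s t : ℝ) (hs : 1 < s) (hst : s ≤ t) :
    ((s + Real.sqrt (s ^ 2 - 1)) ^ p - (s - Real.sqrt (s ^ 2 - 1)) ^ p) / Real.sqrt (s ^ 2 - 1) ≤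
      ((t + Real.sqrt (t ^ 2 - 1)) ^ p - (t - Real.sqrt (t ^ 2 - 1)) ^ p) /
        Real.sqrt (t ^ 2 - 1) := by
  rw [rpow_sub_rpow_div_sqrt_eq_sinh p hs, rpow_sub_rpow_div_sqrt_eq_sinh p (hs.trans_le hst)]
  have hu : 0 < Real.arsinh (Real.sqrt (s ^ 2 - 1)) :=
    Real.arsinh_pos_iff.2 (Real.sqrt_pos.2 (by nlinarith))
  have huv : Real.arsinh (Real.sqrt (s ^ 2 - 1)) ≤ Real.arsinh (Real.sqrt (t ^ 2 - 1)) :=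
    Real.arsinh_le_arsinh.2 (Real.sqrt_le_sqrt (by nlinarith))
  exact mul_le_mul_of_nonneg_left
    (Real.monotoneOn_sinh_mul_div_sinh hp hu (hu.trans_le huv) huv) zero_le_two
end

section
/- Fix a real number p ≥ 1. For every real θ with 0 < θ < 1/p and θ < 1, one has ln((pθ + 1)(1 − θ)^p) ≥ ln((1 − pθ)(1 + θ)^p); equivalently, (pθ + 1)(1 − θ)^p ≥ (1 − pθ)(1 + θ)^p. -/
/-- The function `x ↦ log (1 + x) - log (1 - x)` is superhomogeneous on `[0, 1)`. -/
theorem mul_log_sub_log_le {p x : ℝ} (hp : 1 ≤ p) (hx : 0 ≤ x) (hpx : p * x < 1) :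
    p * (Real.log (1 + x) - Real.log (1 - x)) ≤
      Real.log (1 + p * x) - Real.log (1 - p * x) := by
  have hx1 : x < 1 := by nlinarith
  have h₁ := (Real.hasSum_log_sub_log_of_abs_lt_one
    (abs_lt.2 ⟨by linarith, hx1⟩)).mul_left p
  have h₂ := Real.hasSum_log_sub_log_of_abs_lt_one
    (x := p * x) (abs_lt.2 ⟨by nlinarith, hpx⟩)
  refine hasSum_le (fun k => ?_) h₁ h₂
  have hpow : p ≤ p ^ (2 * k + 1) := le_self_pow₀ hp (by omega)
  calc p * (2 * (1 / (2 * (k : ℝ) + 1)) * x ^ (2 * k + 1))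
      = 2 * (1 / (2 * (k : ℝ) + 1)) * (p * x ^ (2 * k + 1)) := by ring
    _ ≤ 2 * (1 / (2 * (k : ℝ) + 1)) * (p * x) ^ (2 * k + 1) := by
      rw [mul_pow]
      gcongr

theorem log_ineq_ge_one (p : ℝ) (hp : 1 ≤ p) (θ : ℝ) (hθ0 : 0 < θ) (hθp : θ < 1 / p)
    (hθ1 : θ < 1) :
    Real.log ((1 - p * θ) * (1 + θ) ^ p) ≤ Real.log ((p * θ + 1) * (1 - θ) ^ p) ∧
      (1 - p * θ) * (1 + θ) ^ p ≤ (p * θ + 1) * (1 - θ) ^ p := by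
  have hp0 : 0 < p := by linarith
  have hpθ : p * θ < 1 := by rwa [lt_div_iff₀ hp0, mul_comm] at hθp
  have h₁ : 0 < 1 - p * θ := by linarith
  have h₂ : 0 < 1 - θ := by linarith
  have h₃ : 0 < p * θ + 1 := by positivity
  have h₄ : 0 < 1 + θ := by linarith
  have hlog : Real.log ((1 - p * θ) * (1 + θ) ^ p) ≤
      Real.log ((p * θ + 1) * (1 - θ) ^ p) := by
    rw [Real.log_mul h₁.ne' (by positivity), Real.log_mul h₃.ne' (by positivity),
      Real.log_rpow h₄, Real.log_rpow h₂, add_comm (p * θ) 1]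
    linarith [mul_log_sub_log_le hp hθ0.le hpθ]
  exact ⟨hlog, (Real.log_le_log_iff (by positivity) (by positivity)).1 hlog⟩
end

section
/- Fix a real number p with 0 < p < 1. For every real θ with 0 < θ < 1, one has ln((pθ + 1)(1 − θ)^p) ≤ ln((1 − pθ)(1 + θ)^p); equivalently, (pθ + 1)(1 − θ)^p ≤ (1 − pθ)(1 + θ)^p. -/
theorem log_one_add_sub_log_one_sub_mul_le {p x : ℝ} (hp0 : 0 ≤ p) (hp1 : p ≤ 1)
    (hx0 : 0 ≤ x) (hx1 : x < 1) :
    Real.log (1 + p * x) - Real.log (1 - p * x) ≤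
      p * (Real.log (1 + x) - Real.log (1 - x)) := by
  have hpx : p * x ≤ x := mul_le_of_le_one_left hx0 hp1
  have hpx0 : 0 ≤ p * x := mul_nonneg hp0 hx0
  have hx : |x| < 1 := by rwa [abs_of_nonneg hx0]
  have hy : |p * x| < 1 := by rw [abs_of_nonneg hpx0]; linarith
  refine hasSum_le (fun k => ?_) (Real.hasSum_log_sub_log_of_abs_lt_one hy)
    ((Real.hasSum_log_sub_log_of_abs_lt_one hx).mul_left p)
  have hpow : p ^ (2 * k + 1) ≤ p := pow_le_of_le_one hp0 hp1 (by lia)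
  calc 2 * (1 / (2 * (k : ℝ) + 1)) * (p * x) ^ (2 * k + 1)
      = p ^ (2 * k + 1) * (2 * (1 / (2 * (k : ℝ) + 1)) * x ^ (2 * k + 1)) := by
        rw [mul_pow]; ring
    _ ≤ p * (2 * (1 / (2 * (k : ℝ) + 1)) * x ^ (2 * k + 1)) := by gcongr

theorem log_ineq_lt_one (p : ℝ) (hp0 : 0 < p) (hp1 : p < 1) (θ : ℝ) (hθ0 : 0 < θ)
    (hθ1 : θ < 1) :
    Real.log ((p * θ + 1) * (1 - θ) ^ p) ≤ Real.log ((1 - p * θ) * (1 + θ) ^ p) ∧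
      (p * θ + 1) * (1 - θ) ^ p ≤ (1 - p * θ) * (1 + θ) ^ p := by
  have hpθ : p * θ < 1 := mul_lt_one_of_nonneg_of_lt_one_left hp0.le hp1 hθ1.le
  have h1 : 0 < p * θ + 1 := by positivity
  have h2 : 0 < 1 - p * θ := by linarith
  have h3 : 0 < 1 - θ := by linarith
  have h4 : 0 < 1 + θ := by linarith
  have h5 : 0 < (1 - θ) ^ p := Real.rpow_pos_of_pos h3 p
  have h6 : 0 < (1 + θ) ^ p := Real.rpow_pos_of_pos h4 p
  have hlog : Real.log ((p * θ + 1) * (1 - θ) ^ p) ≤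
      Real.log ((1 - p * θ) * (1 + θ) ^ p) := by
    rw [Real.log_mul h1.ne' h5.ne', Real.log_mul h2.ne' h6.ne', Real.log_rpow h3,
      Real.log_rpow h4, add_comm (p * θ)]
    linarith [log_one_add_sub_log_one_sub_mul_le hp0.le hp1.le hθ0.le hθ1]
  exact ⟨hlog, (Real.log_le_log_iff (mul_pos h1 h5) (mul_pos h2 h6)).mp hlog⟩
end
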